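/- arXiv:1110.4275 — 3 statements merged into one kernel-verified Lean document; each statement's English description precedes it below -/
import Mathlib

section
/- Conversely, with the setup of the exact sequence 0 → M → ℤ^r → C → 0 as above: if m ∈ M satisfies ⟨m, v_k⟩ = -1, ⟨m, v_i⟩ = 0 for all i ∈ S, and ⟨m, v_i⟩ ≥ 0 for all i ∉ S ∪ {k}, then the submonoid of C generated by {[D_i] : i ∉ S} equals the submonoid generated by {[D_i] : i ∉ S ∪ {k}}. -/
/-- The natural pairing between the lattice `M = Fin d → ℤ` and its dual `N = Fin d → ℤ`. -/
def pairing {d : ℕ} (m v : Fin d → ℤ) : ℤ := ∑ i, m i * v i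

/-- The map `M → ℤʳ`, `m ↦ (⟨m, v 1⟩, …, ⟨m, v r⟩)`. -/
def raysMap {d r : ℕ} (v : Fin r → Fin d → ℤ) : (Fin d → ℤ) →ₗ[ℤ] (Fin r → ℤ) where
  toFun m := fun i => pairing m (v i)
  map_add' a b := by
    ext i; simp [pairing, add_mul, Finset.sum_add_distrib]
  map_smul' c a := by
    ext i; simp [pairing, Finset.mul_sum, mul_assoc]

/-- The cokernel `C = ℤʳ / M` of `raysMap` (the divisor class group). -/
abbrev DivClassGroup {d r : ℕ} (v : Fin r → Fin d → ℤ) : Type :=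
  (Fin r → ℤ) ⧸ LinearMap.range (raysMap v)

/-- The class `[D i]` of the `i`-th basis vector of `ℤʳ` in the cokernel. -/
def Dclass {d r : ℕ} (v : Fin r → Fin d → ℤ) (i : Fin r) : DivClassGroup v :=
  Submodule.Quotient.mk (Pi.single i 1)

/-- conversely, if `m ∈ M` satisfies `⟨m, v k⟩ = -1`, `⟨m, v i⟩ = 0` for
`i ∈ S` and `⟨m, v i⟩ ≥ 0` for `i ∉ S ∪ {k}`, then the submonoid of `C` generated by
`{[D i] : i ∉ S}` equals the submonoid generated by `{[D i] : i ∉ S ∪ {k}}`. -/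
theorem stmt3 {d r : ℕ} (v : Fin r → Fin d → ℤ)
    (hinj : Function.Injective (raysMap v))
    (S : Finset (Fin r)) (k : Fin r) (hk : k ∉ S) (m : Fin d → ℤ)
    (hm : pairing m (v k) = -1)
    (hS : ∀ i ∈ S, pairing m (v i) = 0)
    (hpos : ∀ i, i ∉ S → i ≠ k → 0 ≤ pairing m (v i)) :
    AddSubmonoid.closure {c : DivClassGroup v | ∃ i, i ∉ S ∧ c = Dclass v i} =
      AddSubmonoid.closure {c : DivClassGroup v | ∃ i, i ∉ S ∧ i ≠ k ∧ c = Dclass v i} := by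
  have hsum : ∑ i, pairing m (v i) • Dclass v i = 0 := by
    have h0 : (LinearMap.range (raysMap v)).mkQ (raysMap v m) = 0 := by
      rw [Submodule.mkQ_apply, Submodule.Quotient.mk_eq_zero]
      exact ⟨m, rfl⟩
    have h1 : raysMap v m = ∑ i, pairing m (v i) • (Pi.single i 1 : Fin r → ℤ) := by
      ext j
      simp [raysMap, Finset.sum_apply, Pi.single_apply]
    rw [h1, map_sum] at h0
    simp only [map_smul] at h0
    exact h0
  have hkey : Dclass v k = ∑ i ∈ Finset.univ.erase k, pairing m (v i) • Dclass v i := by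
    rw [← Finset.add_sum_erase _ _ (Finset.mem_univ k), hm, neg_one_smul] at hsum
    exact (neg_add_eq_zero.mp hsum)
  apply le_antisymm
  · rw [AddSubmonoid.closure_le]
    rintro c ⟨i, hi, rfl⟩
    by_cases hik : i = k
    · subst hik
      rw [hkey]
      refine AddSubmonoid.sum_mem _ ?_
      intro j hj
      have hjk := Finset.ne_of_mem_erase hj
      by_cases hjS : j ∈ S
      · rw [hS j hjS, zero_smul]
        exact AddSubmonoid.zero_mem _
      · obtain ⟨n, hn⟩ := Int.eq_ofNat_of_zero_le (hpos j hjS hjk)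
        rw [hn, natCast_zsmul]
        refine nsmul_mem ?_ n
        exact AddSubmonoid.subset_closure ⟨j, hjS, hjk, rfl⟩
    · exact AddSubmonoid.subset_closure ⟨i, hi, hik, rfl⟩
  · apply AddSubmonoid.closure_mono
    rintro c ⟨i, hi, _, rfl⟩
    exact ⟨i, hi, rfl⟩
end

section
/- Let Δ be a complete fan and define, for each cone σ generated by a subset of the rays of Δ, the monoid Γ(σ) = Σ_{τ_i ∉ σ(1)} ℤ_{≥0}[D_i] in the class group Cl = ℤ^r / im(M). If σ_1 is a facet of σ_2, σ_2(1) = σ_1(1) ∪ {τ_k}, and there is a Demazure root m with ⟨m, v_k⟩ = -1, m|_{σ_2} ≤ 0 and σ_1 = σ_2 ∩ m^⊥, then Γ(σ_1) = Γ(σ_2). -/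
/-- The submonoid `Γ(σ)` of the class group generated by the classes `[D i]` of the
divisors whose rays `τ i` are not rays of `σ` (`σ` being encoded by its ray set `S`). -/
noncomputable def Γmonoid {d r : ℕ} (v : Fin r → Fin d → ℤ) (S : Finset (Fin r)) :
    AddSubmonoid (DivClassGroup v) :=
  AddSubmonoid.closure {c | ∃ i, i ∉ S ∧ c = Dclass v i}

/-- if `σ₁` (with ray set `S₁`) is a facet of `σ₂` (with ray set
`S₂ = S₁ ∪ {k}`), and `m` is a Demazure root with distinguished ray `τ k` such that
`m ≤ 0` on `σ₂` and `σ₁ = σ₂ ∩ m^⊥`, then `Γ(σ₁) = Γ(σ₂)`. -/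
theorem stmt4 {d r : ℕ} (v : Fin r → Fin d → ℤ)
    (hinj : Function.Injective (raysMap v))
    (S₁ S₂ : Finset (Fin r)) (k : Fin r) (hk : k ∉ S₁) (hS₂ : S₂ = insert k S₁)
    (m : Fin d → ℤ)
    (hroot : pairing m (v k) = -1 ∧ ∀ j, j ≠ k → 0 ≤ pairing m (v j))
    (hneg : ∀ i ∈ S₂, pairing m (v i) ≤ 0)
    (hperp : ∀ i ∈ S₁, pairing m (v i) = 0) :
    Γmonoid v S₁ = Γmonoid v S₂ := by
  have key : Dclass v k = ∑ j ∈ Finset.univ.erase k, (pairing m (v j)).toNat • Dclass v j := by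
    have h1 : (Pi.single k 1 : Fin r → ℤ) + raysMap v m
        = ∑ j ∈ Finset.univ.erase k, (pairing m (v j)).toNat • (Pi.single j 1 : Fin r → ℤ) := by
      ext i
      rw [Finset.sum_apply]
      simp only [Pi.add_apply, Pi.smul_apply, Pi.single_apply]
      have h3 : raysMap v m i = pairing m (v i) := rfl
      rw [h3]
      by_cases hi : i = k
      · subst hi
        rw [Finset.sum_eq_zero]
        · simp [hroot.1]
        · intro j hj
          simp [(Finset.ne_of_mem_erase hj).symm]
      · rw [Finset.sum_eq_single i]
        · simp [hi, hroot.2 i hi]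
        · intro j _ hj
          simp [hj.symm]
        · intro h
          simp [hi] at h
    have h2 := congrArg (LinearMap.range (raysMap v)).mkQ h1
    rw [map_add, map_sum] at h2
    simp only [map_nsmul] at h2
    have h4 : (LinearMap.range (raysMap v)).mkQ (raysMap v m) = 0 := by
      rw [Submodule.mkQ_apply, Submodule.Quotient.mk_eq_zero]
      exact ⟨m, rfl⟩
    rw [h4, add_zero] at h2
    exact h2
  subst hS₂
  apply le_antisymm
  · refine AddSubmonoid.closure_le.2 ?_
    rintro c ⟨i, hi, rfl⟩
    by_cases hik : i = k
    · subst hik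
      rw [key]
      refine AddSubmonoid.sum_mem _ fun j hj => ?_
      by_cases hj1 : j ∈ S₁
      · rw [hperp j hj1]
        simp
      · have hmem : Dclass v j ∈ Γmonoid v (insert i S₁) :=
          AddSubmonoid.subset_closure ⟨j, by simp [hj1, Finset.ne_of_mem_erase hj], rfl⟩
        exact AddSubmonoid.nsmul_mem _ hmem _
    · exact AddSubmonoid.subset_closure ⟨i, by simp [hi, hik], rfl⟩
  · refine AddSubmonoid.closure_mono ?_
    rintro c ⟨i, hi, rfl⟩
    exact ⟨i, fun h => hi (Finset.mem_insert_of_mem h), rfl⟩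
end

section
/- Let Δ be a complete fan with rays τ_1,...,τ_r, Cl the cokernel of M → ℤ^r, and Γ(σ) the submonoid of Cl generated by {[D_i] : τ_i ∉ σ(1)}. Define Υ(Δ) = {Γ(σ) : σ ∈ Δ}. Then for any cone σ generated by a subset of {τ_1,...,τ_r}: σ ∈ Δ if and only if Γ(σ) ∈ Υ(Δ). -/
/-- The rays as vectors of `N ⊗ ℚ = Fin d → ℚ`. -/
def vQ {d r : ℕ} (v : Fin r → Fin d → ℤ) (i : Fin r) : Fin d → ℚ := fun j => (v i j : ℚ)

/-- The convex cone in `N ⊗ ℚ` generated by the rays `v i`, `i ∈ S`. -/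
def coneOf {d r : ℕ} (v : Fin r → Fin d → ℤ) (S : Set (Fin r)) :
    PointedCone ℚ (Fin d → ℚ) :=
  Submodule.span {c : ℚ // 0 ≤ c} (vQ v '' S)

/-- `F` is a face of the cone `σ`: it is cut out of `σ` by a linear functional which is
nonnegative on `σ`. -/
def IsFaceOf {d : ℕ} (F σ : PointedCone ℚ (Fin d → ℚ)) : Prop :=
  F ≤ σ ∧ ∃ l : (Fin d → ℚ) →ₗ[ℚ] ℚ,
    (∀ x ∈ σ, 0 ≤ l x) ∧ ∀ x ∈ σ, (x ∈ F ↔ l x = 0)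

/-- The submonoid `Γ(σ)` of the class group generated by the classes `[D i]` with
`v i ∉ σ`. -/
noncomputable def Γcone {d r : ℕ} (v : Fin r → Fin d → ℤ)
    (σ : PointedCone ℚ (Fin d → ℚ)) : AddSubmonoid (DivClassGroup v) :=
  AddSubmonoid.closure {c | ∃ i, vQ v i ∉ σ ∧ c = Dclass v i}

open scoped Matrix in
/-- Farkas' lemma over `ℚ`. -/
lemma farkas_aux {d : ℕ} {ι : Type} [DecidableEq ι] (s : Finset ι) :
    ∀ (g : ι → Fin d → ℚ) (b : Fin d → ℚ),
    (∀ y : Fin d → ℚ, (∀ i ∈ s, 0 ≤ g i ⬝ᵥ y) → 0 ≤ b ⬝ᵥ y) →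
    ∃ c : ι → ℚ, (∀ i, 0 ≤ c i) ∧ b = ∑ i ∈ s, c i • g i := by
  induction s using Finset.induction_on with
  | empty =>
    intro g b h
    refine ⟨0, fun _ => le_rfl, ?_⟩
    have h1 := h (-b) (by simp)
    have h2 : 0 ≤ b ⬝ᵥ b := Finset.sum_nonneg fun i _ => mul_self_nonneg _
    rw [dotProduct_neg] at h1
    have h3 : b ⬝ᵥ b = 0 := by linarith
    simpa using dotProduct_self_eq_zero.mp h3
  | insert k s hk ih =>
    intro g b h
    by_cases hb : ∀ y : Fin d → ℚ, (∀ i ∈ s, 0 ≤ g i ⬝ᵥ y) → 0 ≤ b ⬝ᵥ y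
    · obtain ⟨c, hc, hbc⟩ := ih g b hb
      refine ⟨fun i => if i = k then 0 else c i, fun i => by dsimp only; split_ifs <;> simp [hc], ?_⟩
      rw [Finset.sum_insert hk, hbc]
      simp only [if_true, zero_smul, zero_add]
      refine Finset.sum_congr rfl fun i hi => ?_
      rw [if_neg (ne_of_mem_of_not_mem hi hk)]
    · push Not at hb
      obtain ⟨x, hx, hbx⟩ := hb
      have hkx : g k ⬝ᵥ x < 0 := by
        by_contra hcon
        push Not at hcon
        have := h x (by
          intro i hi
          rcases Finset.mem_insert.mp hi with rfl | hi
          · exact hcon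
          · exact hx i hi)
        linarith
      set t : ℚ := -(g k ⬝ᵥ x)⁻¹ with ht
      have htpos : 0 < t := by rw [ht]; have := inv_lt_zero.mpr hkx; linarith
      have htk : t * (g k ⬝ᵥ x) = -1 := by rw [ht, neg_mul, inv_mul_cancel₀ hkx.ne]
      obtain ⟨c, hc, hbc⟩ := ih (fun i => g i + (t * (g i ⬝ᵥ x)) • g k)
        (b + (t * (b ⬝ᵥ x)) • g k) (by
          intro y hy
          have := h (y + (t * (g k ⬝ᵥ y)) • x) (by
            intro i hi
            rcases Finset.mem_insert.mp hi with rfl | hi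
            · rw [dotProduct_add, dotProduct_smul, smul_eq_mul]
              have : t * (g i ⬝ᵥ y) * (g i ⬝ᵥ x) = (g i ⬝ᵥ y) * (t * (g i ⬝ᵥ x)) := by ring
              rw [this, htk]; linarith
            · have := hy i hi
              simp only [add_dotProduct, smul_dotProduct, dotProduct_add, dotProduct_smul,
                smul_eq_mul] at this ⊢
              linarith)
          simp only [add_dotProduct, smul_dotProduct, dotProduct_add, dotProduct_smul,
                smul_eq_mul] at this ⊢
          linarith)
      have hsum : 0 ≤ ∑ i ∈ s, c i * (t * (g i ⬝ᵥ x)) :=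
        Finset.sum_nonneg fun i hi => mul_nonneg (hc i) (mul_nonneg htpos.le (hx i hi))
      refine ⟨fun i => if i = k then (∑ i ∈ s, c i * (t * (g i ⬝ᵥ x))) - t * (b ⬝ᵥ x) else c i,
        ?_, ?_⟩
      · intro i
        dsimp only
        split_ifs
        · have := mul_pos_of_neg_of_neg hbx (neg_neg_of_pos htpos)
          linarith
        · exact hc i
      · rw [Finset.sum_insert hk]
        have e : ∑ i ∈ s, (if i = k then (∑ i ∈ s, c i * (t * (g i ⬝ᵥ x))) - t * (b ⬝ᵥ x)
            else c i) • g i = ∑ i ∈ s, c i • g i :=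
          Finset.sum_congr rfl fun i hi => by rw [if_neg (ne_of_mem_of_not_mem hi hk)]
        rw [e]
        simp only [if_true, smul_add, Finset.sum_add_distrib, smul_smul, ← Finset.sum_smul] at hbc ⊢
        rw [sub_smul]
        rw [← eq_sub_iff_add_eq] at hbc
        conv_lhs => rw [hbc]
        abel

open scoped Matrix in
lemma strict_aux {d : ℕ} {ι : Type} [DecidableEq ι] [Fintype ι] (g : ι → Fin d → ℚ) :
    ∃ y : Fin d → ℚ, (∀ i, 0 ≤ g i ⬝ᵥ y) ∧
      ∀ i, g i ⬝ᵥ y = 0 → ∃ c : ι → ℚ, (∀ j, 0 ≤ c j) ∧ -g i = ∑ j, c j • g j := by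
  have key : ∀ i, ∃ y : Fin d → ℚ, (∀ j, 0 ≤ g j ⬝ᵥ y) ∧
      (g i ⬝ᵥ y = 0 → ∃ c : ι → ℚ, (∀ j, 0 ≤ c j) ∧ -g i = ∑ j, c j • g j) := by
    intro i
    by_cases h : ∀ y : Fin d → ℚ, (∀ j ∈ Finset.univ, 0 ≤ g j ⬝ᵥ y) → 0 ≤ (-g i) ⬝ᵥ y
    · exact ⟨0, by simp, fun _ => farkas_aux Finset.univ g (-g i) h⟩
    · push Not at h
      obtain ⟨y, hy, hlt⟩ := h
      refine ⟨y, fun j => hy j (Finset.mem_univ _), fun h0 => ?_⟩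
      rw [neg_dotProduct, h0] at hlt
      simp at hlt
  choose y hy1 hy2 using key
  refine ⟨∑ i, y i, ?_, ?_⟩
  · intro i
    rw [dotProduct_sum]
    exact Finset.sum_nonneg fun j _ => hy1 j i
  · intro i h0
    rw [dotProduct_sum, Finset.sum_eq_zero_iff_of_nonneg (fun j _ => hy1 j i)] at h0
    exact hy2 i (h0 i (Finset.mem_univ _))

lemma clear_aux {d : ℕ} (y : Fin d → ℚ) :
    ∃ (m : Fin d → ℤ) (N : ℚ), 0 < N ∧ ∀ j, (m j : ℚ) = N * y j := by
  have : ∀ j, ∃ k : ℕ, (∏ i, (y i).den) = (y j).den * k := fun j =>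
    Finset.dvd_prod_of_mem _ (Finset.mem_univ j)
  choose k hk using this
  refine ⟨fun j => k j * (y j).num, ((∏ i, (y i).den : ℕ) : ℚ), ?_, ?_⟩
  · exact_mod_cast Finset.prod_pos fun i _ => (y i).den_pos
  · intro j
    rw [hk j]
    push_cast
    have := Rat.den_mul_eq_num (y j)
    rw [← this]; ring

lemma cone_smul {d : ℕ} (σ : PointedCone ℚ (Fin d → ℚ)) {x : Fin d → ℚ} (hx : x ∈ σ) {c : ℚ}
    (hc : 0 ≤ c) : c • x ∈ σ := σ.smul_mem hc hx

lemma face_aux {d : ℕ} {F σ : PointedCone ℚ (Fin d → ℚ)} (h : IsFaceOf F σ) {x s : Fin d → ℚ}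
    (hx : x ∈ σ) (hs : s ∈ σ) (hxs : x + s ∈ F) : x ∈ F := by
  obtain ⟨hle, l, h1, h2⟩ := h
  have h3 := (h2 _ (hle hxs)).mp hxs
  rw [map_add] at h3
  exact (h2 x hx).mpr (by linarith [h1 x hx, h1 s hs])

open scoped Matrix in
lemma sep_aux {d r : ℕ} (v : Fin r → Fin d → ℤ) (σ τ : PointedCone ℚ (Fin d → ℚ))
    (h1 : IsFaceOf (σ ⊓ τ) σ) (h2 : IsFaceOf (σ ⊓ τ) τ) :
    ∃ y : Fin d → ℚ, (∀ i, vQ v i ∈ σ → 0 ≤ vQ v i ⬝ᵥ y ∧ (vQ v i ⬝ᵥ y = 0 → vQ v i ∈ τ)) ∧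
      (∀ i, vQ v i ∈ τ → vQ v i ⬝ᵥ y ≤ 0 ∧ (vQ v i ⬝ᵥ y = 0 → vQ v i ∈ σ)) := by
  classical
  obtain ⟨y, hy1, hy2⟩ := strict_aux (ι := Fin r ⊕ Fin r)
    (Sum.elim (fun i => if vQ v i ∈ σ then vQ v i else 0)
      (fun i => if vQ v i ∈ τ then -vQ v i else 0))
  have dec : ∀ c : Fin r ⊕ Fin r → ℚ, (∀ j, 0 ≤ c j) → ∃ s ∈ σ, ∃ t ∈ τ,
      ∑ j, c j • (Sum.elim (fun i => if vQ v i ∈ σ then vQ v i else 0)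
      (fun i => if vQ v i ∈ τ then -vQ v i else 0) : Fin r ⊕ Fin r → Fin d → ℚ) j = s - t := by
    intro c hc
    refine ⟨∑ i, c (Sum.inl i) • (if vQ v i ∈ σ then vQ v i else 0), ?_,
      ∑ i, c (Sum.inr i) • (if vQ v i ∈ τ then vQ v i else 0), ?_, ?_⟩
    · refine sum_mem fun i _ => cone_smul σ ?_ (hc _)
      split_ifs with h
      · exact h
      · exact zero_mem _
    · refine sum_mem fun i _ => cone_smul τ ?_ (hc _)
      split_ifs with h
      · exact h
      · exact zero_mem _
    · rw [Fintype.sum_sum_type, sub_eq_add_neg, ← Finset.sum_neg_distrib]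
      congr 1
      refine Finset.sum_congr rfl fun i _ => ?_
      rw [← smul_neg]
      simp only [Sum.elim_inr]
      split_ifs <;> simp
  refine ⟨y, fun i hi => ⟨?_, fun h0 => ?_⟩, fun i hi => ⟨?_, fun h0 => ?_⟩⟩
  · simpa [hi] using hy1 (Sum.inl i)
  · obtain ⟨c, hc, e⟩ := hy2 (Sum.inl i) (by simpa [hi] using h0)
    obtain ⟨s, hs, t, ht, e'⟩ := dec c hc
    rw [e'] at e
    simp only [Sum.elim_inl, hi, if_true] at e
    have e2 : vQ v i + s = t := by
      rw [neg_eq_iff_eq_neg] at e; rw [e]; abel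
    exact (face_aux h1 hi hs ⟨add_mem hi hs, by simpa [e2] using ht⟩).2
  · simpa [hi] using hy1 (Sum.inr i)
  · obtain ⟨c, hc, e⟩ := hy2 (Sum.inr i) (by simpa [hi] using h0)
    obtain ⟨s, hs, t, ht, e'⟩ := dec c hc
    rw [e'] at e
    simp only [Sum.elim_inr, hi, if_true, neg_neg] at e
    have e2 : vQ v i + t = s := by rw [e]; abel
    exact (face_aux h2 hi ht ⟨by simpa [e2] using hs, add_mem hi ht⟩).1

open scoped Matrix in
lemma pairing_cast {d r : ℕ} (v : Fin r → Fin d → ℤ) (m : Fin d → ℤ) (i : Fin r) :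
    ((raysMap v m i : ℤ) : ℚ) = vQ v i ⬝ᵥ (fun j => (m j : ℚ)) := by
  simp [raysMap, pairing, vQ, dotProduct, mul_comm]

open scoped Matrix in
lemma sep_int {d r : ℕ} (v : Fin r → Fin d → ℤ) (σ τ : PointedCone ℚ (Fin d → ℚ))
    (h1 : IsFaceOf (σ ⊓ τ) σ) (h2 : IsFaceOf (σ ⊓ τ) τ) :
    ∃ m : Fin d → ℤ,
      (∀ i, vQ v i ∈ σ → 0 ≤ raysMap v m i ∧ (raysMap v m i = 0 → vQ v i ∈ τ)) ∧
      (∀ i, vQ v i ∈ τ → raysMap v m i ≤ 0 ∧ (raysMap v m i = 0 → vQ v i ∈ σ)) := by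
  obtain ⟨y, hy1, hy2⟩ := sep_aux v σ τ h1 h2
  obtain ⟨m, N, hN, hm⟩ := clear_aux y
  have key : ∀ i, ((raysMap v m i : ℤ) : ℚ) = N * (vQ v i ⬝ᵥ y) := by
    intro i
    rw [pairing_cast, show (fun j => (m j : ℚ)) = N • y from funext hm, dotProduct_smul,
      smul_eq_mul]
  have key0 : ∀ i, raysMap v m i = 0 → vQ v i ⬝ᵥ y = 0 := by
    intro i h
    have := key i
    rw [h, Int.cast_zero, eq_comm, mul_eq_zero] at this
    exact this.resolve_left hN.ne'
  refine ⟨m, fun i hi => ⟨?_, fun h => (hy1 i hi).2 (key0 i h)⟩,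
    fun i hi => ⟨?_, fun h => (hy2 i hi).2 (key0 i h)⟩⟩
  · have : (0 : ℚ) ≤ (raysMap v m i : ℤ) := by
      rw [key]; exact mul_nonneg hN.le (hy1 i hi).1
    exact_mod_cast this
  · have : ((raysMap v m i : ℤ) : ℚ) ≤ 0 := by
      rw [key]; exact mul_nonpos_of_nonneg_of_nonpos hN.le (hy2 i hi).1
    exact_mod_cast this

lemma mem_Γ {d r : ℕ} (v : Fin r → Fin d → ℤ) (σ : PointedCone ℚ (Fin d → ℚ))
    (c : DivClassGroup v) : c ∈ Γcone v σ ↔ ∃ a : Fin r → ℤ, (∀ i, 0 ≤ a i) ∧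
      (∀ i, vQ v i ∈ σ → a i = 0) ∧ c = Submodule.Quotient.mk a := by
  constructor
  · intro hc
    induction hc using AddSubmonoid.closure_induction with
    | mem x hx =>
      obtain ⟨i, hi, rfl⟩ := hx
      refine ⟨Pi.single i 1, ?_, ?_, rfl⟩
      · intro j; by_cases h : j = i
        · subst h; simp
        · simp [h]
      · intro j hj
        have : j ≠ i := by rintro rfl; exact hi hj
        simp [this]
    | zero => exact ⟨0, fun _ => le_rfl, fun _ _ => rfl, rfl⟩
    | add x y _ _ hx hy =>
      obtain ⟨a, ha, ha', rfl⟩ := hx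
      obtain ⟨b, hb, hb', rfl⟩ := hy
      exact ⟨a + b, fun i => add_nonneg (ha i) (hb i),
        fun i hi => by simp [ha' i hi, hb' i hi], rfl⟩
  · rintro ⟨a, ha, ha', rfl⟩
    have e : (Submodule.Quotient.mk a : DivClassGroup v) = ∑ i, (a i).toNat • Dclass v i := by
      have : a = ∑ i, (a i).toNat • (Pi.single i 1 : Fin r → ℤ) := by
        funext j
        simp [Finset.sum_apply, Pi.single_apply, ha j]
      conv_lhs => rw [this]
      change Submodule.mkQ _ _ = _
      rw [map_sum]
      refine Finset.sum_congr rfl fun i _ => ?_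
      rw [map_nsmul]; rfl
    rw [e]
    refine sum_mem fun i _ => ?_
    by_cases hi : vQ v i ∈ σ
    · simp [ha' i hi]
    · have hmem : Dclass v i ∈ Γcone v σ := AddSubmonoid.subset_closure ⟨i, hi, rfl⟩
      exact nsmul_mem hmem _

/-- Strictly positive representatives: the relative interiors of `Γ(σ)` and `Γ(τ)` meet. -/
lemma interior_meet {d r : ℕ} (v : Fin r → Fin d → ℤ) (σ τ : PointedCone ℚ (Fin d → ℚ))
    (h1 : IsFaceOf (σ ⊓ τ) σ) (h2 : IsFaceOf (σ ⊓ τ) τ) :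
    ∃ a b : Fin r → ℤ, (∀ i, vQ v i ∈ σ → a i = 0) ∧ (∀ i, vQ v i ∉ σ → 0 < a i) ∧
      (∀ i, vQ v i ∈ τ → b i = 0) ∧ (∀ i, vQ v i ∉ τ → 0 < b i) ∧
      (Submodule.Quotient.mk a : DivClassGroup v) = Submodule.Quotient.mk b := by
  classical
  obtain ⟨m, hm1, hm2⟩ := sep_int v σ τ h1 h2
  set f := raysMap v m with hf
  refine ⟨fun i => if vQ v i ∈ σ then 0 else if vQ v i ∈ τ then - f i else 1 + |f i|,
    fun i => if vQ v i ∈ τ then 0 else if vQ v i ∈ σ then f i else 1 + |f i| + f i,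
    ?_, ?_, ?_, ?_, ?_⟩
  · intro i hi; simp [hi]
  · intro i hi
    simp only [hi, if_false]
    split_ifs with h
    · have := hm2 i h
      have h3 : f i ≠ 0 := fun h0 => hi (this.2 h0)
      have := this.1
      omega
    · have := abs_nonneg (f i); omega
  · intro i hi; simp [hi]
  · intro i hi
    simp only [hi, if_false]
    split_ifs with h
    · have := hm1 i h
      have h3 : f i ≠ 0 := fun h0 => hi (this.2 h0)
      have := this.1
      omega
    · have := neg_abs_le (f i); omega
  · rw [eq_comm, Submodule.Quotient.eq]
    refine ⟨m, ?_⟩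
    funext i
    simp only [Pi.sub_apply, ← hf]
    split_ifs with h h' h'
    · have := (hm1 i h').1
      have := (hm2 i h).1
      omega
    · omega
    · omega
    · omega

lemma transfer {d r : ℕ} (v : Fin r → Fin d → ℤ) (σ σ' τ : PointedCone ℚ (Fin d → ℚ))
    (hΓ : Γcone v σ = Γcone v σ')
    (h1 : IsFaceOf (σ' ⊓ τ) σ') (h2 : IsFaceOf (σ' ⊓ τ) τ) :
    ∃ a b : Fin r → ℤ, (∀ i, vQ v i ∈ σ → a i = 0) ∧ (∀ i, vQ v i ∉ σ → 0 < a i) ∧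
      (∀ i, vQ v i ∈ τ → b i = 0) ∧ (∀ i, vQ v i ∉ τ → 0 < b i) ∧
      (Submodule.Quotient.mk a : DivClassGroup v) = Submodule.Quotient.mk b := by
  classical
  obtain ⟨a, b, ha0, ha1, hb0, hb1, hab⟩ := interior_meet v σ' τ h1 h2
  let u : Fin r → ℤ := fun i => if vQ v i ∈ σ then 0 else 1
  have hu : (Submodule.Quotient.mk u : DivClassGroup v) ∈ Γcone v σ :=
    (mem_Γ v σ _).mpr ⟨u, fun i => by simp only [u]; split_ifs <;> simp,
      fun i hi => by simp [u, hi], rfl⟩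
  rw [hΓ, mem_Γ] at hu
  obtain ⟨c, hc, hc0, huc⟩ := hu
  let N : ℤ := 1 + ∑ i, c i
  have hN : ∀ i, c i ≤ N := fun i => by
    have := Finset.single_le_sum (f := c) (fun j _ => hc j) (Finset.mem_univ i)
    simp only [N]; omega
  have hNpos : 0 < N := by
    have := Finset.sum_nonneg (fun j (_ : j ∈ Finset.univ) => hc j)
    simp only [N]; omega
  have hrest : (Submodule.Quotient.mk (N • a - c) : DivClassGroup v) ∈ Γcone v σ' := by
    refine (mem_Γ v σ' _).mpr ⟨_, ?_, ?_, rfl⟩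
    · intro i
      simp only [Pi.sub_apply, Pi.smul_apply, smul_eq_mul]
      by_cases hi : vQ v i ∈ σ'
      · simp [ha0 i hi, hc0 i hi]
      · have := ha1 i hi
        have := hN i
        nlinarith
    · intro i hi; simp [ha0 i hi, hc0 i hi]
  rw [← hΓ, mem_Γ] at hrest
  obtain ⟨e, he, he0, hee⟩ := hrest
  refine ⟨u + e, N • b, ?_, ?_, ?_, ?_, ?_⟩
  · intro i hi; simp [u, hi, he0 i hi]
  · intro i hi
    have := he i
    simp only [Pi.add_apply, u, hi, if_false]; omega
  · intro i hi; simp [hb0 i hi]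
  · intro i hi
    simpa using mul_pos hNpos (hb1 i hi)
  · rw [Submodule.Quotient.mk_add, huc, ← hee, Submodule.Quotient.mk_smul, ← hab,
      Submodule.Quotient.mk_sub, Submodule.Quotient.mk_smul]
    abel

lemma vQ_mem {d r : ℕ} (v : Fin r → Fin d → ℤ) {S : Set (Fin r)} {i : Fin r} (hi : i ∈ S) :
    vQ v i ∈ coneOf v S := Submodule.subset_span ⟨i, hi, rfl⟩

lemma nonneg_cone {d r : ℕ} (v : Fin r → Fin d → ℤ) (S : Set (Fin r))
    (l : (Fin d → ℚ) →ₗ[ℚ] ℚ) (hl : ∀ i ∈ S, 0 ≤ l (vQ v i)) : ∀ x ∈ coneOf v S, 0 ≤ l x := by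
  intro x hx
  induction hx using Submodule.span_induction with
  | mem x h => obtain ⟨i, hi, rfl⟩ := h; exact hl i hi
  | zero => simp
  | add x y _ _ hx hy => rw [map_add]; exact add_nonneg hx hy
  | smul c x _ hx =>
    have : l (c • x) = (c : ℚ) * l x := by
      rw [show c • x = (c : ℚ) • x from rfl, map_smul, smul_eq_mul]
    rw [this]; exact mul_nonneg c.2 hx

lemma zero_cone {d r : ℕ} (v : Fin r → Fin d → ℤ) (S : Set (Fin r))
    (F : PointedCone ℚ (Fin d → ℚ))
    (l : (Fin d → ℚ) →ₗ[ℚ] ℚ) (hl : ∀ i ∈ S, 0 ≤ l (vQ v i))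
    (hF : ∀ i ∈ S, l (vQ v i) = 0 → vQ v i ∈ F) :
    ∀ x ∈ coneOf v S, l x = 0 → x ∈ F := by
  intro x hx
  induction hx using Submodule.span_induction with
  | mem x h => obtain ⟨i, hi, rfl⟩ := h; exact hF i hi
  | zero => simp
  | add x y hx' hy' hx hy =>
    intro h
    rw [map_add] at h
    have h1 := nonneg_cone v S l hl x hx'
    have h2 := nonneg_cone v S l hl y hy'
    exact add_mem (hx (by linarith)) (hy (by linarith))
  | smul c x _ hx =>
    have : l (c • x) = (c : ℚ) * l x := by
      rw [show c • x = (c : ℚ) • x from rfl, map_smul, smul_eq_mul]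
    rw [this, mul_eq_zero]
    rintro (h | h)
    · rw [show c • x = (c : ℚ) • x from rfl, h, zero_smul]; exact zero_mem _
    · exact Submodule.smul_mem F c (hx h)


/-- for a complete fan `Δ` whose cones are generated by subsets of the
rays `v 1, …, v r`, and for any cone `σ` generated by a subset of the rays,
`σ ∈ Δ` if and only if `Γ(σ)` lies in `Υ(Δ) = {Γ(σ') : σ' ∈ Δ}`. -/
theorem stmt12 {d r : ℕ} (v : Fin r → Fin d → ℤ)
    (Δ : Set (PointedCone ℚ (Fin d → ℚ)))
    (hfaces : ∀ σ ∈ Δ, ∀ F, IsFaceOf F σ → F ∈ Δ)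
    (hinter : ∀ σ ∈ Δ, ∀ τ ∈ Δ, IsFaceOf (σ ⊓ τ) σ)
    (hcomplete : ∀ x : Fin d → ℚ, ∃ σ ∈ Δ, x ∈ σ)
    (hgen : ∀ σ ∈ Δ, ∃ S : Set (Fin r), σ = coneOf v S)
    (hrays : ∀ i : Fin r, coneOf v {i} ∈ Δ)
    (S : Set (Fin r)) :
    coneOf v S ∈ Δ ↔ Γcone v (coneOf v S) ∈ {G | ∃ σ ∈ Δ, G = Γcone v σ} := by
  classical
  constructor
  · intro h
    exact ⟨_, h, rfl⟩
  rintro ⟨σ', hσ', hΓ⟩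
  obtain ⟨τ, hτ, hxτ⟩ := hcomplete (∑ i, if i ∈ S then vQ v i else 0)
  obtain ⟨a, b, ha0, ha1, hb0, hb1, hab⟩ := transfer v (coneOf v S) σ' τ hΓ (hinter σ' hσ' τ hτ)
    (by rw [inf_comm]; exact hinter τ hτ σ' hσ')
  rw [Submodule.Quotient.eq] at hab
  obtain ⟨m, hm⟩ := hab
  let l : (Fin d → ℚ) →ₗ[ℚ] ℚ :=
    { toFun := fun x => dotProduct x (fun j => (m j : ℚ))
      map_add' := fun x y => add_dotProduct _ _ _
      map_smul' := fun c x => smul_dotProduct _ _ _ }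
  have hl : ∀ i, l (vQ v i) = (a i : ℚ) - b i := by
    intro i
    have : l (vQ v i) = ((raysMap v m i : ℤ) : ℚ) := (pairing_cast v m i).symm
    rw [this, hm]; simp
  have hann : ∀ i, (0 : ℚ) ≤ a i := fun i => by
    by_cases hi : vQ v i ∈ coneOf v S
    · simp [ha0 i hi]
    · exact_mod_cast (ha1 i hi).le
  have hbnn : ∀ i, (0 : ℚ) ≤ b i := fun i => by
    by_cases hi : vQ v i ∈ τ
    · simp [hb0 i hi]
    · exact_mod_cast (hb1 i hi).le
  obtain ⟨T, rfl⟩ := hgen τ hτ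
  have hT : ∀ i ∈ T, l (vQ v i) = a i := fun i hi => by
    rw [hl, hb0 i (vQ_mem v hi)]; simp
  have hS : ∀ i ∈ S, l (vQ v i) = -b i := fun i hi => by
    rw [hl, ha0 i (vQ_mem v hi)]; simp
  have hTnn : ∀ i ∈ T, 0 ≤ l (vQ v i) := fun i hi => by rw [hT i hi]; exact hann i
  have hτnn := nonneg_cone v T l hTnn
  have hσnp := nonneg_cone v S (-l) (fun i hi => by simp [hS i hi, hbnn i])
  have hsum : ∑ i, (if i ∈ S then (b i : ℚ) else 0) ≤ 0 := by
    have h := hτnn _ hxτ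
    rw [map_sum] at h
    have e : ∑ i, l (if i ∈ S then vQ v i else 0) = -∑ i, (if i ∈ S then (b i : ℚ) else 0) := by
      rw [← Finset.sum_neg_distrib]
      refine Finset.sum_congr rfl fun i _ => ?_
      split_ifs with hi
      · exact hS i hi
      · simp
    rw [e] at h
    linarith
  have hnn : ∀ i ∈ Finset.univ, 0 ≤ (if i ∈ S then (b i : ℚ) else 0) := fun i _ => by
    split_ifs
    · exact hbnn i
    · exact le_rfl
  have hz := (Finset.sum_eq_zero_iff_of_nonneg hnn).mp
    (le_antisymm hsum (Finset.sum_nonneg hnn))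
  have hle : coneOf v S ≤ coneOf v T := by
    refine Submodule.span_le.mpr ?_
    rintro _ ⟨i, hi, rfl⟩
    by_contra hcon
    have h1 := hz i (Finset.mem_univ i)
    rw [if_pos hi] at h1
    have h2 := hb1 i hcon
    have h3 : b i = 0 := by exact_mod_cast h1
    omega
  refine hfaces _ hτ _ ⟨hle, l, hτnn, fun x hx => ⟨fun hxS => ?_, ?_⟩⟩
  · have h1 := hτnn x hx
    have h2 := hσnp x hxS
    rw [LinearMap.neg_apply] at h2
    linarith
  · refine zero_cone v T (coneOf v S) l hTnn (fun i hi h0 => ?_) x hx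
    by_contra hcon
    have h1 := ha1 i hcon
    rw [hT i hi] at h0
    have h3 : a i = 0 := by exact_mod_cast h0
    omega
end
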